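/- Let E be a separable real normed space with its Borel σ-algebra, let ρ, ρ₁, ρ₂ be probability measures on E, and let α ≥ 1 be a real number. Define the mixed measures ρ̃₁ = α⁻¹·ρ₁ + (1 − α⁻¹)·ρ and ρ̃₂ = α⁻¹·ρ₂ + (1 − α⁻¹)·ρ. Then W₂(ρ̃₁, ρ̃₂)² ≤ α⁻¹ · W₂(ρ₁, ρ₂)²; equivalently, W₂(ρ̃₁, ρ̃₂) ≤ α^{-1/2} · W₂(ρ₁, ρ₂). -/

import Mathlib

open MeasureTheory ENNReal

/-- The set of couplings of two measures. -/
def couplings {E : Type*} [MeasurableSpace E] (μ ν : Measure E) : Set (Measure (E × E)) :=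
  {γ | γ.map Prod.fst = μ ∧ γ.map Prod.snd = ν}

/-- Squared Wasserstein-2 distance with the squared-norm cost, valued in `[0, ∞]`. -/
noncomputable def W2sq {E : Type*} [NormedAddCommGroup E] [MeasurableSpace E]
    (μ ν : Measure E) : ℝ≥0∞ :=
  ⨅ γ ∈ couplings μ ν, ∫⁻ p : E × E, ENNReal.ofReal (‖p.1 - p.2‖ ^ 2) ∂γ

/-- Mixing with a common component contracts the squared Wasserstein-2 distance:
for `ρ̃ᵢ = α⁻¹·ρᵢ + (1 − α⁻¹)·ρ` with `α ≥ 1`, one has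
`W₂(ρ̃₁, ρ̃₂)² ≤ α⁻¹ · W₂(ρ₁, ρ₂)²`. -/
theorem W2sq_mix_le {E : Type*} [NormedAddCommGroup E] [MeasurableSpace E]
    [BorelSpace E] [TopologicalSpace.SeparableSpace E]
    (ρ ρ₁ ρ₂ : Measure E) [IsProbabilityMeasure ρ]
    [IsProbabilityMeasure ρ₁] [IsProbabilityMeasure ρ₂]
    (α : ℝ) (hα : 1 ≤ α) :
    W2sq (ENNReal.ofReal α⁻¹ • ρ₁ + ENNReal.ofReal (1 - α⁻¹) • ρ)
        (ENNReal.ofReal α⁻¹ • ρ₂ + ENNReal.ofReal (1 - α⁻¹) • ρ)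
      ≤ ENNReal.ofReal α⁻¹ * W2sq ρ₁ ρ₂ := by
  have hc0 : ENNReal.ofReal α⁻¹ ≠ 0 := by
    have : 0 < α⁻¹ := inv_pos.mpr (by linarith)
    simpa using this
  have : SecondCountableTopology E := UniformSpace.secondCountable_of_separable E
  have hd : Measurable (fun x : E => (x, x)) := measurable_id.prodMk measurable_id
  have hm : Measurable (fun p : E × E => ENNReal.ofReal (‖p.1 - p.2‖ ^ 2)) :=
    (((measurable_fst.sub measurable_snd).norm).pow_const 2).ennreal_ofReal
  unfold W2sq
  rw [ENNReal.mul_iInf_of_ne hc0 ENNReal.ofReal_ne_top]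
  refine le_iInf fun γ => ?_
  rw [ENNReal.mul_iInf_of_ne hc0 ENNReal.ofReal_ne_top]
  refine le_iInf fun hγ => ?_
  obtain ⟨h1, h2⟩ := hγ
  refine (iInf₂_le (ENNReal.ofReal α⁻¹ • γ +
    ENNReal.ofReal (1 - α⁻¹) • ρ.map (fun x : E => (x, x))) ⟨?_, ?_⟩).trans ?_
  rotate_left
  · rw [Measure.map_add _ _ measurable_fst, Measure.map_smul, Measure.map_smul, h1,
      Measure.map_map measurable_fst hd]
    congr 2
    exact Measure.map_id
  · rw [Measure.map_add _ _ measurable_snd, Measure.map_smul, Measure.map_smul, h2,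
      Measure.map_map measurable_snd hd]
    congr 2
    exact Measure.map_id
  · rw [lintegral_add_measure, lintegral_smul_measure, lintegral_smul_measure,
      lintegral_map hm hd]
    simp
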